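/- Let T, p, q, P, Q be as in the setup, let ñ = rank(P) (the number of nonzero entries of p) and m̃ = rank(Q), and let T̲, P̲, Q̲ be the compressions to the supports of P and Q. Then cap(T̲, P̲, Q̲) ≥ cap(T, P, Q). -/

import Mathlib

open Matrix BigOperators

noncomputable section

/-- `η_j` : the projection onto the first `j` coordinates, as a `j × k` matrix. -/
def proj (j k : ℕ) : Matrix (Fin j) (Fin k) ℂ :=
  Matrix.of fun i l => if (i : ℕ) = (l : ℕ) then 1 else 0

/-- `Δa_j = a_j − a_{j+1}`, with the convention `a_{k+1} = 0`. -/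
def delta {k : ℕ} (a : Fin k → ℝ) (j : Fin k) : ℝ :=
  a j - (if h : (j : ℕ) + 1 < k then a ⟨(j : ℕ) + 1, h⟩ else 0)

/-- Integer version of `delta`. -/
def deltaNat {k : ℕ} (a : Fin k → ℕ) (j : Fin k) : ℕ :=
  a j - (if h : (j : ℕ) + 1 < k then a ⟨(j : ℕ) + 1, h⟩ else 0)

/-- The relative determinant `det(diag a, X) = ∏_j det(η_j X η_j†)^{Δa_j}` (real exponents,
with the convention `0 ^ 0 = 1`). -/
def relDet {k : ℕ} (a : Fin k → ℝ) (X : Matrix (Fin k) (Fin k) ℂ) : ℝ :=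
  ∏ j : Fin k,
    ((proj ((j : ℕ) + 1) k * X * (proj ((j : ℕ) + 1) k)ᴴ).det.re) ^ (delta a j)

/-- Complex relative determinant for integral weights. -/
def relDetC {k : ℕ} (a : Fin k → ℕ) (X : Matrix (Fin k) (Fin k) ℂ) : ℂ :=
  ∏ j : Fin k,
    ((proj ((j : ℕ) + 1) k * X * (proj ((j : ℕ) + 1) k)ᴴ).det) ^ (deltaNat a j)

/-- The completely positive map `T(X) = Σ A_i X A_i†` with Kraus operators `A i`. -/
def cpMap {ι κ : Type*} [Fintype ι] {r : ℕ} (A : Fin r → Matrix κ ι ℂ)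
    (X : Matrix ι ι ℂ) : Matrix κ κ ℂ :=
  ∑ i, A i * X * (A i)ᴴ

/-- The dual completely positive map `T*(Y) = Σ A_i† Y A_i`. -/
def cpDual {ι κ : Type*} [Fintype κ] {r : ℕ} (A : Fin r → Matrix κ ι ℂ)
    (Y : Matrix κ κ ℂ) : Matrix ι ι ℂ :=
  ∑ i, (A i)ᴴ * Y * A i

/-- Frobenius norm `‖A‖ = √(Tr A Aᴴ)`. -/
def frob {ι κ : Type*} [Fintype ι] [Fintype κ] (A : Matrix ι κ ℂ) : ℝ :=
  Real.sqrt (A * Aᴴ).trace.re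

/-- Upper triangular predicate. -/
def UT {k : ℕ} (g : Matrix (Fin k) (Fin k) ℂ) : Prop :=
  ∀ i j : Fin k, j < i → g i j = 0

/-- Capacity with specified marginals:
`cap(T,P,Q) = inf over invertible upper triangular h of det(Q, T(hPh†)) / det(P, h†h)`. -/
def cap {n m r : ℕ} (A : Fin r → Matrix (Fin m) (Fin n) ℂ)
    (p : Fin n → ℝ) (q : Fin m → ℝ) : ℝ :=
  sInf { x : ℝ | ∃ h : Matrix (Fin n) (Fin n) ℂ, IsUnit h.det ∧ UT h ∧
    x = relDet q (cpMap A (h * Matrix.diagonal (fun j => (p j : ℂ)) * hᴴ)) /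
        relDet p (hᴴ * h) }

/-- Span of the first `i` standard basis vectors of `ℂ^k`. -/
def coordSub (k i : ℕ) : Submodule ℂ (Fin k → ℂ) where
  carrier := { x | ∀ l : Fin k, i ≤ (l : ℕ) → x l = 0 }
  add_mem' := by intro a b ha hb l hl; simp [ha l hl, hb l hl]
  zero_mem' := by intro l _; rfl
  smul_mem' := by intro c x hx l hl; simp [hx l hl]

/-- `(L, R)` is a `T`-independent pair: `A_i R ⊥ L` for all `i`. -/
def TIndep {n m r : ℕ} (A : Fin r → Matrix (Fin m) (Fin n) ℂ)
    (L : Submodule ℂ (Fin m → ℂ)) (R : Submodule ℂ (Fin n → ℂ)) : Prop :=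
  ∀ i : Fin r, ∀ x ∈ R, ∀ y ∈ L, star y ⬝ᵥ (A i).mulVec x = 0

/-- `(P,Q)`-rank-nondecreasingness. -/
def rankNonDec {n m r : ℕ} (A : Fin r → Matrix (Fin m) (Fin n) ℂ)
    (p : Fin n → ℝ) (q : Fin m → ℝ) : Prop :=
  ∀ L : Submodule ℂ (Fin m → ℂ), ∀ R : Submodule ℂ (Fin n → ℂ), TIndep A L R →
    (∑ i : Fin m, delta q i * (Module.finrank ℂ ↥(coordSub m ((i : ℕ) + 1) ⊓ L) : ℝ)) +
      (∑ j : Fin n, delta p j * (Module.finrank ℂ ↥(coordSub n ((j : ℕ) + 1) ⊓ R) : ℝ))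
      ≤ ∑ j, p j

/-- `λ'_{i+1}`: number of parts of `lam` that are `> i` (0-indexed conjugate partition). -/
def conj' {k : ℕ} (lam : Fin k → ℕ) (i : ℕ) : ℕ :=
  (Finset.univ.filter fun j : Fin k => i < lam j).card

lemma conj'_le {k : ℕ} (lam : Fin k → ℕ) (i : ℕ) : conj' lam i ≤ k := by
  classical
  calc conj' lam i ≤ Finset.univ.card := Finset.card_filter_le _ _
    _ = k := by simp

/-- Index set for the blocks of `G_λ`; it has cardinality `Σ_i λ'_i = Σ_j λ_j`. -/
abbrev lamIdx {k : ℕ} (lam : Fin k → ℕ) : Type :=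
  Σ i : Fin (Finset.univ.sup lam), Fin (conj' lam (i : ℕ))

/-- The gadget map `G_λ(X) = ⊕_{i=1}^{λ_1} η_{λ'_i} X η_{λ'_i}†`. -/
def Gmap {k : ℕ} (lam : Fin k → ℕ) (X : Matrix (Fin k) (Fin k) ℂ) :
    Matrix (lamIdx lam) (lamIdx lam) ℂ := fun s t =>
  if s.1 = t.1 then
    X (Fin.castLE (conj'_le lam (s.1 : ℕ)) s.2) (Fin.castLE (conj'_le lam (t.1 : ℕ)) t.2)
  else 0

/-- The adjoint `G_λ*` of the gadget map with respect to the trace inner product. -/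
def GmapAdj {k : ℕ} (lam : Fin k → ℕ) (Y : Matrix (lamIdx lam) (lamIdx lam) ℂ) :
    Matrix (Fin k) (Fin k) ℂ := fun a b =>
  ∑ i : Fin (Finset.univ.sup lam),
    if h : (a : ℕ) < conj' lam (i : ℕ) ∧ (b : ℕ) < conj' lam (i : ℕ) then
      Y ⟨i, ⟨(a : ℕ), h.1⟩⟩ ⟨i, ⟨(b : ℕ), h.2⟩⟩
    else 0

/-- The reduction `trun_{P,Q} T = G_q ∘ T ∘ G_p*`. -/
def trun {n m r : ℕ} (A : Fin r → Matrix (Fin m) (Fin n) ℂ) (p : Fin n → ℕ) (q : Fin m → ℕ)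
    (X : Matrix (lamIdx p) (lamIdx p) ℂ) : Matrix (lamIdx q) (lamIdx q) ℂ :=
  Gmap q (cpMap A (GmapAdj p X))

/-- The dual of the reduction: `(trun_{P,Q} T)* = G_p ∘ T* ∘ G_q*`. -/
def trunDual {n m r : ℕ} (A : Fin r → Matrix (Fin m) (Fin n) ℂ) (p : Fin n → ℕ) (q : Fin m → ℕ)
    (Y : Matrix (lamIdx q) (lamIdx q) ℂ) : Matrix (lamIdx p) (lamIdx p) ℂ :=
  Gmap p (cpDual A (GmapAdj q Y))

/-- Shannon entropy with convention `0 · log 0 = 0` (note `Real.log 0 = 0`). -/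
def entropy {k : ℕ} (p : Fin k → ℝ) : ℝ := -∑ j, p j * Real.log (p j)

/-- The distance-to-target measure `ds_{P,Q}(T)`. -/
def ds {n m r : ℕ} (A : Fin r → Matrix (Fin m) (Fin n) ℂ)
    (p : Fin n → ℝ) (q : Fin m → ℝ) : ℝ :=
  (∑ j : Fin n, delta p j *
      (frob (proj ((j : ℕ) + 1) n *
        (cpDual A (Matrix.diagonal fun i => (q i : ℂ)) - 1) * (proj ((j : ℕ) + 1) n)ᴴ)) ^ 2) +
    ∑ i : Fin m, delta q i *
      (frob (proj ((i : ℕ) + 1) m *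
        (cpMap A (Matrix.diagonal fun j => (p j : ℂ)) - 1) * (proj ((i : ℕ) + 1) m)ᴴ)) ^ 2

/-- `(u_1,…,u_n)` can be approximately put in `Q`-isotropic position with respect to `p`. -/
def approxIso {m n : ℕ} (u : Fin n → Fin m → ℂ) (p : Fin n → ℝ)
    (Q : Matrix (Fin m) (Fin m) ℂ) : Prop :=
  ∀ ε : ℝ, 0 < ε → ∃ B : Matrix (Fin m) (Fin m) ℂ, IsUnit B.det ∧
    frob ((∑ i : Fin n,
      (((p i / ∑ a, Complex.normSq (B.mulVec (u i) a)) : ℝ) : ℂ) •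
        Matrix.vecMulVec (B.mulVec (u i)) (star (B.mulVec (u i)))) - Q) ≤ ε

lemma proj_mul_proj {i j k : ℕ} (hij : i ≤ j) : proj i j * proj j k = proj i k := by
  ext a c
  rw [Matrix.mul_apply, Finset.sum_eq_single (Fin.castLE hij a)]
  · simp [proj]
  · intro b _ hb
    have : (a : ℕ) ≠ b := fun h => hb (Fin.ext h.symm)
    simp [proj, this]
  · simp

lemma proj_mul_conjTranspose {j k : ℕ} (hjk : j ≤ k) : proj j k * (proj j k)ᴴ = 1 := by
  ext a c
  rw [Matrix.mul_apply, Finset.sum_eq_single (Fin.castLE hjk a)]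
  · simp [proj, Matrix.one_apply, Fin.ext_iff, eq_comm, apply_ite]
  · intro b _ hb
    have : (a : ℕ) ≠ b := fun h => hb (Fin.ext h.symm)
    simp [proj, this]
  · simp

lemma delta_castLE {k l : ℕ} (hlk : l ≤ k) (a : Fin k → ℝ)
    (ha : ∀ j : Fin k, l ≤ (j : ℕ) → a j = 0) (j : Fin l) :
    delta (fun i => a (Fin.castLE hlk i)) j = delta a (Fin.castLE hlk j) := by
  unfold delta
  congr 1
  have hj := j.isLt
  by_cases h : (j : ℕ) + 1 < l
  · have h' : (j : ℕ) + 1 < k := by omega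
    simp [h, h']
  · by_cases h' : (j : ℕ) + 1 < k
    · have := ha ⟨(j : ℕ) + 1, h'⟩ (by simp; omega)
      simp [h, h', this]
    · simp [h, h']

lemma delta_eq_zero {k l : ℕ} (a : Fin k → ℝ)
    (ha : ∀ j : Fin k, l ≤ (j : ℕ) → a j = 0) (j : Fin k) (hj : l ≤ (j : ℕ)) :
    delta a j = 0 := by
  unfold delta
  rw [ha j hj]
  by_cases h : (j : ℕ) + 1 < k
  · have := ha ⟨(j : ℕ) + 1, h⟩ (by simp; omega)
    simp [h, this]
  · simp [h]

/-- The relative determinant only depends on the compression to the support of the weights. -/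
lemma relDet_compress {k l : ℕ} (hlk : l ≤ k) (a : Fin k → ℝ)
    (ha : ∀ j : Fin k, l ≤ (j : ℕ) → a j = 0) (X : Matrix (Fin k) (Fin k) ℂ) :
    relDet (fun i => a (Fin.castLE hlk i)) (proj l k * X * (proj l k)ᴴ) = relDet a X := by
  unfold relDet
  refine Finset.prod_of_injOn (Fin.castLE hlk) (Fin.castLE_injective hlk).injOn (by simp) ?_ ?_
  · intro j _ hj
    have hlj : l ≤ (j : ℕ) := by
      by_contra! h
      exact hj ⟨⟨j, h⟩, by simp, by simp⟩
    rw [delta_eq_zero a ha j hlj, Real.rpow_zero]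
  · intro j _
    rw [delta_castLE hlk a ha]
    have h : proj ((j : ℕ) + 1) l * proj l k = proj ((j : ℕ) + 1) k := proj_mul_proj j.isLt
    have h2 : proj ((j : ℕ) + 1) l * (proj l k * X * (proj l k)ᴴ) * (proj ((j : ℕ) + 1) l)ᴴ
        = proj ((j : ℕ) + 1) k * X * (proj ((j : ℕ) + 1) k)ᴴ := by
      rw [← h, Matrix.conjTranspose_mul]
      simp only [Matrix.mul_assoc]
    rw [h2]
    rfl

open scoped ComplexOrder in
lemma relDet_nonneg {k : ℕ} (a : Fin k → ℝ) {X : Matrix (Fin k) (Fin k) ℂ}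
    (hX : X.PosSemidef) : 0 ≤ relDet a X :=
  Finset.prod_nonneg fun j _ => Real.rpow_nonneg
    (Complex.le_def.mp (hX.mul_mul_conjTranspose_same (proj ((j : ℕ) + 1) k)).det_nonneg).1 _

open scoped ComplexOrder in
lemma cpMap_posSemidef {ι κ : Type*} [Fintype ι] [Fintype κ] {r : ℕ}
    (A : Fin r → Matrix κ ι ℂ) {X : Matrix ι ι ℂ} (hX : X.PosSemidef) :
    (cpMap A X).PosSemidef :=
  Matrix.posSemidef_sum _ fun i _ => hX.mul_mul_conjTranspose_same (A i)

/-- Extension of an `l × l` matrix by the identity to a `k × k` matrix. -/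
def extendOne {l : ℕ} (k : ℕ) (h : Matrix (Fin l) (Fin l) ℂ) : Matrix (Fin k) (Fin k) ℂ :=
  fun i j => if hij : (i : ℕ) < l ∧ (j : ℕ) < l then h ⟨i, hij.1⟩ ⟨j, hij.2⟩
    else if i = j then 1 else 0

lemma UT.extendOne {k l : ℕ} {h : Matrix (Fin l) (Fin l) ℂ} (hh : UT h) :
    UT (extendOne k h) := by
  intro i j hji
  unfold _root_.extendOne
  split_ifs with h1 h2
  · exact hh _ _ hji
  · exact absurd h2 hji.ne'
  · rfl

lemma UT.isUnit_det_iff {k : ℕ} {h : Matrix (Fin k) (Fin k) ℂ} (hh : UT h) :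
    IsUnit h.det ↔ ∀ i, h i i ≠ 0 := by
  rw [Matrix.det_of_isUpperTriangular (fun i j hij => hh i j hij), isUnit_iff_ne_zero,
    Finset.prod_ne_zero_iff]
  simp

lemma isUnit_det_extendOne {k l : ℕ} {h : Matrix (Fin l) (Fin l) ℂ} (hh : UT h)
    (hu : IsUnit h.det) : IsUnit (extendOne k h).det := by
  rw [hh.extendOne.isUnit_det_iff]
  rw [hh.isUnit_det_iff] at hu
  intro i
  by_cases hi : (i : ℕ) < l
  · simpa [extendOne, hi] using hu ⟨i, hi⟩
  · simp [extendOne, hi]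

lemma mul_conjTranspose_proj_apply {ι : Type*} {k l : ℕ} (hlk : l ≤ k)
    (X : Matrix ι (Fin k) ℂ) (i : ι) (j : Fin l) :
    (X * (proj l k)ᴴ) i j = X i (Fin.castLE hlk j) := by
  rw [Matrix.mul_apply, Finset.sum_eq_single (Fin.castLE hlk j)]
  · simp [proj]
  · intro b _ hb
    have : (j : ℕ) ≠ b := fun h => hb (Fin.ext h.symm)
    simp [proj, this]
  · simp

lemma conjTranspose_proj_mul_apply {ι : Type*} {k l : ℕ} (X : Matrix (Fin l) ι ℂ)
    (i : Fin k) (j : ι) :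
    ((proj l k)ᴴ * X) i j = if h : (i : ℕ) < l then X ⟨i, h⟩ j else 0 := by
  rw [Matrix.mul_apply]
  split_ifs with h
  · rw [Finset.sum_eq_single ⟨i, h⟩]
    · simp [proj]
    · intro b _ hb
      have : (b : ℕ) ≠ i := fun h => hb (Fin.ext h)
      simp [proj, this]
    · simp
  · refine Finset.sum_eq_zero fun b _ => ?_
    have : (b : ℕ) ≠ i := by have := b.isLt; omega
    simp [proj, this]

lemma extendOne_mul_conjTranspose_proj {k l : ℕ} (hlk : l ≤ k) (h : Matrix (Fin l) (Fin l) ℂ) :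
    extendOne k h * (proj l k)ᴴ = (proj l k)ᴴ * h := by
  ext i j
  rw [mul_conjTranspose_proj_apply hlk, conjTranspose_proj_mul_apply]
  by_cases hi : (i : ℕ) < l
  · simp [extendOne, hi]
  · have : i ≠ Fin.castLE hlk j := by
      rintro rfl
      exact hi j.isLt
    simp [extendOne, hi, this]

lemma diagonal_eq_compress {k l : ℕ} (hlk : l ≤ k) (a : Fin k → ℝ)
    (ha : ∀ j : Fin k, l ≤ (j : ℕ) → a j = 0) :
    Matrix.diagonal (fun j => (a j : ℂ)) =
      (proj l k)ᴴ * Matrix.diagonal (fun j => (a (Fin.castLE hlk j) : ℂ)) * proj l k := by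
  ext i j
  rw [Matrix.mul_assoc, conjTranspose_proj_mul_apply]
  by_cases hi : (i : ℕ) < l
  · simp [hi, proj, Matrix.diagonal_apply, Fin.ext_iff]
  · simp [hi, Matrix.diagonal_apply, ha i (not_lt.mp hi)]

open scoped ComplexOrder in
lemma cap_bddBelow {n m r : ℕ} (A : Fin r → Matrix (Fin m) (Fin n) ℂ)
    (p : Fin n → ℝ) (q : Fin m → ℝ) (hp0 : ∀ j, 0 ≤ p j) :
    BddBelow { x : ℝ | ∃ h : Matrix (Fin n) (Fin n) ℂ, IsUnit h.det ∧ UT h ∧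
      x = relDet q (cpMap A (h * Matrix.diagonal (fun j => (p j : ℂ)) * hᴴ)) /
        relDet p (hᴴ * h) } := by
  refine ⟨0, ?_⟩
  rintro x ⟨h, -, -, rfl⟩
  have hP : (Matrix.diagonal (fun j => (p j : ℂ))).PosSemidef :=
    Matrix.PosSemidef.diagonal fun j => by simpa using hp0 j
  exact div_nonneg (relDet_nonneg _ (cpMap_posSemidef _ (hP.mul_mul_conjTranspose_same h)))
    (relDet_nonneg _ (Matrix.posSemidef_conjTranspose_mul_self h))

/-- Lemma: the capacity does not decrease under compression to the supports of `P` and `Q`: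
`cap(T̲, P̲, Q̲) ≥ cap(T, P, Q)`.  Here `nt = rank P`, `mt = rank Q`. -/
theorem stmt8 {n m r : ℕ} (A : Fin r → Matrix (Fin m) (Fin n) ℂ)
    (p : Fin n → ℝ) (q : Fin m → ℝ)
    (hp : Antitone p) (hp0 : ∀ j, 0 ≤ p j) (hq : Antitone q) (hq0 : ∀ i, 0 ≤ q i)
    (nt mt : ℕ) (hnt : nt ≤ n) (hmt : mt ≤ m)
    (hntc : ∀ j : Fin n, 0 < p j ↔ (j : ℕ) < nt)
    (hmtc : ∀ i : Fin m, 0 < q i ↔ (i : ℕ) < mt) :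
    cap A p q ≤
      cap (fun i => proj mt m * A i * (proj nt n)ᴴ)
        (fun j => p (Fin.castLE hnt j)) (fun i => q (Fin.castLE hmt i)) := by
  have hpz : ∀ j : Fin n, nt ≤ (j : ℕ) → p j = 0 := fun j hj =>
    le_antisymm (not_lt.mp fun h => absurd ((hntc j).mp h) (not_lt.mpr hj)) (hp0 j)
  have hqz : ∀ i : Fin m, mt ≤ (i : ℕ) → q i = 0 := fun i hi =>
    le_antisymm (not_lt.mp fun h => absurd ((hmtc i).mp h) (not_lt.mpr hi)) (hq0 i)
  refine csInf_le_csInf (cap_bddBelow A p q hp0) ?_ ?_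
  · exact ⟨_, 1, by simp, fun i j hij => Matrix.one_apply_ne hij.ne', rfl⟩
  · rintro x ⟨h, hu, hut, rfl⟩
    refine ⟨extendOne n h, isUnit_det_extendOne hut hu, hut.extendOne, ?_⟩
    have hE := extendOne_mul_conjTranspose_proj hnt h
    have hE' : proj nt n * (extendOne n h)ᴴ = hᴴ * proj nt n := by
      simpa using congrArg Matrix.conjTranspose hE
    rw [← relDet_compress hnt p hpz, ← relDet_compress hmt q hqz, diagonal_eq_compress hnt p hpz]
    congr 2
    · simp only [cpMap, Matrix.mul_sum, Matrix.sum_mul]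
      refine Finset.sum_congr rfl fun i _ => ?_
      have hX : extendOne n h * ((proj nt n)ᴴ *
          Matrix.diagonal (fun j => (p (Fin.castLE hnt j) : ℂ)) * proj nt n) * (extendOne n h)ᴴ =
          (proj nt n)ᴴ * (h * Matrix.diagonal (fun j => (p (Fin.castLE hnt j) : ℂ)) * hᴴ) *
            proj nt n := by
        rw [Matrix.mul_assoc _ _ (extendOne n h)ᴴ, Matrix.mul_assoc _ (proj nt n), hE',
          ← Matrix.mul_assoc, ← Matrix.mul_assoc, ← Matrix.mul_assoc, hE]
        simp only [Matrix.mul_assoc]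
      rw [hX]
      simp only [Matrix.conjTranspose_mul, Matrix.conjTranspose_conjTranspose, Matrix.mul_assoc]
    · calc hᴴ * h = hᴴ * (proj nt n * (proj nt n)ᴴ) * h := by
            rw [proj_mul_conjTranspose hnt, Matrix.mul_one]
        _ = (hᴴ * proj nt n) * ((proj nt n)ᴴ * h) := by simp only [Matrix.mul_assoc]
        _ = proj nt n * ((extendOne n h)ᴴ * extendOne n h) * (proj nt n)ᴴ := by
            rw [← hE, ← hE']
            simp only [Matrix.mul_assoc]
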